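/- arXiv:1902.01075 — 2 statements merged into one kernel-verified Lean document; each statement's English description precedes it below -/
import Mathlib

section
/- (Multivariate Gaussian penalty norm identity.) Let K(x) = (2π)^{−d/2}·exp(−‖x‖²/2) be the standard Gaussian kernel on ℝ^d, and for a symmetric positive definite d×d matrix H set K_H(x) = det(H)⁻¹K(H⁻¹x). Then ‖K_H‖² = 1/(det(H)·(2√π)^d), and for any two symmetric positive definite matrices H and H_min: ‖K_{H_min} − K_H‖² = 1/(det(H)·(2√π)^d) + 1/(det(H_min)·(2√π)^d) − 2/( √(det(H² + H_min²))·(2π)^{d/2} ), where ‖·‖ is the L²(ℝ^d) norm. -/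
open MeasureTheory ProbabilityTheory Matrix Real

/-- Squared L²-norm of a function on ℝ^d. -/
noncomputable def sqL2 {d : ℕ} (g : (Fin d → ℝ) → ℝ) : ℝ := ∫ x, (g x) ^ 2

/-- L²-norm. -/
noncomputable def L2N {d : ℕ} (g : (Fin d → ℝ) → ℝ) : ℝ := Real.sqrt (sqL2 g)

/-- L² inner product. -/
noncomputable def innL2 {d : ℕ} (g h : (Fin d → ℝ) → ℝ) : ℝ := ∫ x, g x * h x

/-- Sup-norm. -/
noncomputable def supN {d : ℕ} (g : (Fin d → ℝ) → ℝ) : ℝ := (eLpNorm g ⊤ volume).toReal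

/-- L¹-norm. -/
noncomputable def l1N {d : ℕ} (g : (Fin d → ℝ) → ℝ) : ℝ := (eLpNorm g 1 volume).toReal

/-- Rescaled kernel K_H(x) = det(H)⁻¹ K(H⁻¹ x). -/
noncomputable def KH {d : ℕ} (K : (Fin d → ℝ) → ℝ) (H : Matrix (Fin d) (Fin d) ℝ) :
    (Fin d → ℝ) → ℝ := fun x => H.det⁻¹ * K (H⁻¹.mulVec x)

/-- Kernel density estimator with bandwidth matrix H built from the sample X. -/
noncomputable def kde {d : ℕ} (n : ℕ) (K : (Fin d → ℝ) → ℝ) (H : Matrix (Fin d) (Fin d) ℝ)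
    (X : Fin n → Fin d → ℝ) : (Fin d → ℝ) → ℝ :=
  fun x => (n : ℝ)⁻¹ * ∑ i, KH K H (x - X i)

/-- f_H = K_H ⋆ f. -/
noncomputable def smooth {d : ℕ} (K : (Fin d → ℝ) → ℝ) (H : Matrix (Fin d) (Fin d) ℝ)
    (f : (Fin d → ℝ) → ℝ) : (Fin d → ℝ) → ℝ :=
  fun x => ∫ y, KH K H (x - y) * f y

/-- PCO penalty pen_λ(H) = (λ‖K_H‖² − ‖K_{H_min} − K_H‖²)/n. -/
noncomputable def penL {d : ℕ} (n : ℕ) (K : (Fin d → ℝ) → ℝ) (lam : ℝ)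
    (Hmin H : Matrix (Fin d) (Fin d) ℝ) : ℝ :=
  (lam * sqL2 (KH K H) - sqL2 (fun x => KH K Hmin x - KH K H x)) / n

/-- PCO criterion ℓ_PCO(H). -/
noncomputable def lPCO {d : ℕ} (n : ℕ) (K : (Fin d → ℝ) → ℝ) (lam : ℝ)
    (Hmin H : Matrix (Fin d) (Fin d) ℝ) (X : Fin n → Fin d → ℝ) : ℝ :=
  sqL2 (fun x => kde n K Hmin X x - kde n K H X x) + penL n K lam Hmin H

/-- Y has density f with respect to Lebesgue measure, under μ. -/
def HasDensity {Ω : Type} [MeasurableSpace Ω] (μ : Measure Ω) {d : ℕ}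
    (Y : Ω → Fin d → ℝ) (f : (Fin d → ℝ) → ℝ) : Prop :=
  μ.map Y = volume.withDensity (fun x => ENNReal.ofReal (f x))

/-- hbar is a lower bound of all eigenvalues of H. -/
def EigLB {d : ℕ} (hbar : ℝ) (H : Matrix (Fin d) (Fin d) ℝ) : Prop :=
  ∀ (c : ℝ) (v : Fin d → ℝ), v ≠ 0 → H.mulVec v = c • v → hbar ≤ c

/-- The standard Gaussian kernel on ℝ^d. -/
noncomputable def gaussKd (d : ℕ) : (Fin d → ℝ) → ℝ :=
  fun x => (2 * π) ^ (-(d : ℝ) / 2) * Real.exp (-(∑ i, x i ^ 2) / 2)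

theorem two_pi_rpow_half (d : ℕ) : (2 * π) ^ ((d : ℝ) / 2) = √(2 * π) ^ d := by
  rw [Real.sqrt_eq_rpow, ← Real.rpow_natCast, ← Real.rpow_mul (by positivity)]
  congr 1
  ring

theorem two_pi_rpow_neg_half (d : ℕ) : (2 * π) ^ (-(d : ℝ) / 2) = (√(2 * π) ^ d)⁻¹ := by
  rw [neg_div, Real.rpow_neg (by positivity), two_pi_rpow_half]

/-- The integral of the unnormalised standard Gaussian on `ℝ^d`. -/
theorem integral_exp_neg_sum_sq_div_two (d : ℕ) :
    ∫ x : Fin d → ℝ, Real.exp (-(∑ i, x i ^ 2) / 2) = √(2 * π) ^ d := by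
  have h : ∀ x : Fin d → ℝ,
      Real.exp (-(∑ i, x i ^ 2) / 2) = ∏ i, Real.exp (-(1 / 2) * x i ^ 2) := by
    intro x
    rw [← Real.exp_sum, ← Finset.mul_sum]
    congr 1
    ring
  simp_rw [h]
  rw [integral_fintype_prod_volume_eq_pow (fun y : ℝ => Real.exp (-(1 / 2) * y ^ 2)),
    integral_gaussian, Fintype.card_fin]
  congr 2
  ring

/-- Linear change of variables for the Lebesgue integral on `ℝ^d`. -/
theorem integral_comp_mulVec {d : ℕ} {B : Matrix (Fin d) (Fin d) ℝ} (hB : B.det ≠ 0)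
    (g : (Fin d → ℝ) → ℝ) : ∫ x, g (B *ᵥ x) = |B.det|⁻¹ * ∫ x, g x := by
  have hinj : Function.Injective (toLin' B) := by
    simpa [Function.Injective] using
      mulVec_injective_of_isUnit ((B.isUnit_iff_isUnit_det).2 hB.isUnit)
  have hemb : MeasurableEmbedding (toLin' B) :=
    (LinearMap.continuous_of_finiteDimensional _).measurableEmbedding hinj
  have := hemb.integral_map (μ := volume) g
  rw [Real.map_matrix_volume_pi_eq_smul_volume_pi hB, integral_smul_measure,
    ENNReal.toReal_ofReal (abs_nonneg _), abs_inv] at this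
  simpa using this.symm

/-- The Gaussian integral of a positive definite quadratic form. -/
theorem integral_exp_neg_quadratic_div_two {d : ℕ} {A : Matrix (Fin d) (Fin d) ℝ}
    (hA : A.PosDef) :
    ∫ x, Real.exp (-(x ⬝ᵥ A *ᵥ x) / 2) = √(2 * π) ^ d / √A.det := by
  open scoped MatrixOrder in
  obtain ⟨B, hB⟩ := CStarAlgebra.nonneg_iff_eq_star_mul_self.mp hA.posSemidef.nonneg
  have hAB : A = Bᵀ * B := by simpa [star_eq_conjTranspose] using hB
  have hdet : A.det = B.det ^ 2 := by rw [hAB, det_mul, det_transpose, sq]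
  have hB0 : B.det ≠ 0 := by
    intro h
    have := hA.det_pos
    simp [hdet, h] at this
  have hq : ∀ x, x ⬝ᵥ A *ᵥ x = ∑ i, (B *ᵥ x) i ^ 2 := by
    intro x
    rw [hAB, ← mulVec_mulVec, dotProduct_mulVec, vecMul_transpose]
    simp [dotProduct, sq]
  simp_rw [hq]
  rw [integral_comp_mulVec hB0 (fun y => Real.exp (-(∑ i, y i ^ 2) / 2)),
    integral_exp_neg_sum_sq_div_two, hdet, Real.sqrt_sq_eq_abs]
  ring

theorem Matrix.PosDef.sq {d : ℕ} {H : Matrix (Fin d) (Fin d) ℝ} (hH : H.PosDef) :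
    (H ^ 2).PosDef := by
  have h := PosDef.conjTranspose_mul_self H (mulVec_injective_of_isUnit hH.isUnit)
  rwa [hH.isHermitian.eq, ← pow_two] at h

theorem det_inv_sq_add_inv_sq {d : ℕ} {H L : Matrix (Fin d) (Fin d) ℝ}
    (hH : H.det ≠ 0) (hL : L.det ≠ 0) :
    (H⁻¹ ^ 2 + L⁻¹ ^ 2).det = (H ^ 2 + L ^ 2).det / (H.det * L.det) ^ 2 := by
  have h : H ^ 2 * (H⁻¹ ^ 2 + L⁻¹ ^ 2) * L ^ 2 = H ^ 2 + L ^ 2 := by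
    have hu : H * H⁻¹ = 1 := mul_nonsing_inv _ hH.isUnit
    have hv : L⁻¹ * L = 1 := nonsing_inv_mul _ hL.isUnit
    have h1 : H ^ 2 * H⁻¹ ^ 2 = 1 := by
      rw [sq, sq, mul_assoc, ← mul_assoc H H⁻¹, hu, one_mul, hu]
    have h2 : L⁻¹ ^ 2 * L ^ 2 = 1 := by
      rw [sq, sq, mul_assoc, ← mul_assoc L⁻¹ L, hv, one_mul, hv]
    rw [mul_add, add_mul, h1, one_mul, mul_assoc, h2, mul_one, add_comm]
  rw [← h, det_mul, det_mul, det_pow, det_pow]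
  field_simp

theorem KH_gaussKd_mul {d : ℕ} {H L : Matrix (Fin d) (Fin d) ℝ}
    (hH : H.PosDef) (hL : L.PosDef) (x : Fin d → ℝ) :
    KH (gaussKd d) H x * KH (gaussKd d) L x =
      (H.det * L.det)⁻¹ * ((√(2 * π) ^ d)⁻¹) ^ 2 *
        Real.exp (-(x ⬝ᵥ (H⁻¹ ^ 2 + L⁻¹ ^ 2) *ᵥ x) / 2) := by
  have key : ∀ {M : Matrix (Fin d) (Fin d) ℝ}, M.PosDef →
      ∑ i, (M⁻¹ *ᵥ x) i ^ 2 = x ⬝ᵥ M⁻¹ ^ 2 *ᵥ x := by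
    intro M hM
    have hT : (M⁻¹)ᵀ = M⁻¹ := by simpa using hM.inv.isHermitian.eq
    rw [pow_two, ← mulVec_mulVec, dotProduct_mulVec, ← mulVec_transpose, hT]
    simp [dotProduct, pow_two]
  rw [add_mulVec, dotProduct_add, ← key hH, ← key hL, neg_add, add_div, Real.exp_add]
  simp only [KH, gaussKd, two_pi_rpow_neg_half]
  rw [mul_inv]
  ring

/-- The `L²` inner product of two rescaled Gaussian kernels. -/
theorem innL2_KH_gaussKd {d : ℕ} {H L : Matrix (Fin d) (Fin d) ℝ}
    (hH : H.PosDef) (hL : L.PosDef) :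
    innL2 (KH (gaussKd d) H) (KH (gaussKd d) L) =
      1 / (√(H ^ 2 + L ^ 2).det * √(2 * π) ^ d) := by
  have hHd := hH.det_pos
  have hLd := hL.det_pos
  have hS : 0 < √(H ^ 2 + L ^ 2).det := Real.sqrt_pos.2 (hH.sq.add hL.sq).det_pos
  unfold innL2
  simp_rw [KH_gaussKd_mul hH hL]
  rw [integral_const_mul, integral_exp_neg_quadratic_div_two (hH.inv.sq.add hL.inv.sq),
    det_inv_sq_add_inv_sq hHd.ne' hLd.ne', Real.sqrt_div' _ (by positivity),
    Real.sqrt_sq (by positivity)]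
  field_simp

theorem integrable_KH_gaussKd_mul {d : ℕ} {H L : Matrix (Fin d) (Fin d) ℝ}
    (hH : H.PosDef) (hL : L.PosDef) :
    Integrable (fun x => KH (gaussKd d) H x * KH (gaussKd d) L x) := by
  refine Integrable.of_integral_ne_zero ?_
  have hS : 0 < √(H ^ 2 + L ^ 2).det := Real.sqrt_pos.2 (hH.sq.add hL.sq).det_pos
  have h := innL2_KH_gaussKd hH hL
  unfold innL2 at h
  rw [h]
  positivity

/-- The squared `L²` norm of a rescaled Gaussian kernel. -/
theorem sqL2_KH_gaussKd {d : ℕ} {H : Matrix (Fin d) (Fin d) ℝ} (hH : H.PosDef) :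
    sqL2 (KH (gaussKd d) H) = 1 / (H.det * (2 * √π) ^ d) := by
  have h : sqL2 (KH (gaussKd d) H) = innL2 (KH (gaussKd d) H) (KH (gaussKd d) H) := by
    simp only [sqL2, innL2, sq]
  have hdet : √(H ^ 2 + H ^ 2).det = √2 ^ d * H.det := by
    have h2 : (2 : ℝ) ^ d * H.det ^ 2 = (√2 ^ d * H.det) ^ 2 := by
      rw [mul_pow, ← pow_mul, mul_comm d, pow_mul, Real.sq_sqrt (by norm_num)]
    have hpos := hH.det_pos
    rw [← two_smul ℝ (H ^ 2), det_smul, det_pow, Fintype.card_fin, h2,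
      Real.sqrt_sq (by positivity)]
  rw [h, innL2_KH_gaussKd hH hH, hdet, Real.sqrt_mul (by norm_num) π]
  congr 1
  have h2 : √2 * (√2 * √π) = 2 * √π := by
    rw [← mul_assoc, Real.mul_self_sqrt (by norm_num)]
  rw [← h2, mul_pow (√2) (√2 * √π)]
  ring

/-- Multivariate Gaussian penalty norm identities. -/
theorem gaussian_penalty_norms {d : ℕ} (hd : 0 < d)
    (H Hmin : Matrix (Fin d) (Fin d) ℝ) (hH : H.PosDef) (hHmin : Hmin.PosDef) :
    sqL2 (KH (gaussKd d) H) = 1 / (H.det * (2 * Real.sqrt π) ^ d) ∧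
    sqL2 (fun x => KH (gaussKd d) Hmin x - KH (gaussKd d) H x)
      = 1 / (H.det * (2 * Real.sqrt π) ^ d)
        + 1 / (Hmin.det * (2 * Real.sqrt π) ^ d)
        - 2 / (Real.sqrt ((H ^ 2 + Hmin ^ 2).det) * (2 * π) ^ ((d : ℝ) / 2)) := by
  refine ⟨sqL2_KH_gaussKd hH, ?_⟩
  have hexp : ∀ x, (KH (gaussKd d) Hmin x - KH (gaussKd d) H x) ^ 2 =
      KH (gaussKd d) H x * KH (gaussKd d) H x + KH (gaussKd d) Hmin x * KH (gaussKd d) Hmin x -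
        2 * (KH (gaussKd d) H x * KH (gaussKd d) Hmin x) := fun x => by ring
  have hcross := innL2_KH_gaussKd hH hHmin
  have hsqH := sqL2_KH_gaussKd hH
  have hsqHmin := sqL2_KH_gaussKd hHmin
  simp only [sqL2, innL2, sq (KH _ _ _)] at hcross hsqH hsqHmin
  unfold sqL2
  simp_rw [hexp]
  have hHH := integrable_KH_gaussKd_mul hH hH
  have hLL := integrable_KH_gaussKd_mul hHmin hHmin
  have hadd : Integrable (fun x => KH (gaussKd d) H x * KH (gaussKd d) H x +
      KH (gaussKd d) Hmin x * KH (gaussKd d) Hmin x) := hHH.add hLL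
  rw [integral_sub hadd ((integrable_KH_gaussKd_mul hH hHmin).const_mul 2),
    integral_add hHH hLL, integral_const_mul, hcross, hsqH, hsqHmin, two_pi_rpow_half]
  ring
end

section
/- (Multivariate Gaussian comparison term identity.) Let K(x) = (2π)^{−d/2}·exp(−‖x‖²/2) be the standard Gaussian kernel on ℝ^d, K_H(x) = det(H)⁻¹K(H⁻¹x) for a symmetric positive definite matrix H, and for points x₁,…,xₙ ∈ ℝ^d let f̂_H(x) = n⁻¹Σ_{i=1}^n K_H(x−x_i). Then for any symmetric positive definite matrices H and H_min: ‖f̂_{H_min} − f̂_H‖² = (1/n²)·Σ_{i=1}^n Σ_{j=1}^n [ K_{√2·H}(x_i − x_j) − 2·K_{S}(x_i − x_j) + K_{√2·H_min}(x_i − x_j) ], where S is the positive definite square root of H² + H_min² and ‖·‖ is the L²(ℝ^d) norm. -/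
open MeasureTheory ProbabilityTheory Matrix Real

/-- Linear change of variables in a Lebesgue integral over `Fin d → ℝ`. -/
theorem abs_det_mul_integral_comp_mulVec {d : ℕ} (R : Matrix (Fin d) (Fin d) ℝ) (hR : R.det ≠ 0)
    (g : (Fin d → ℝ) → ℝ) : |R.det| * ∫ a, g (R *ᵥ a) = ∫ a, g a := by
  have hunit : IsUnit R := (Matrix.isUnit_iff_isUnit_det R).2 hR.isUnit
  have h := integral_image_eq_integral_abs_det_fderiv_smul (volume : Measure (Fin d → ℝ))
    (s := Set.univ) (f := fun a => R *ᵥ a)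
    (f' := fun _ => LinearMap.toContinuousLinearMap (Matrix.toLin' R)) MeasurableSet.univ
    (fun a _ => ((LinearMap.toContinuousLinearMap (Matrix.toLin' R)).hasFDerivAt
      (x := a)).hasFDerivWithinAt)
    (Matrix.mulVec_injective_iff_isUnit.2 hunit).injOn g
  rw [Set.image_univ, (Matrix.mulVec_surjective_iff_isUnit.2 hunit).range_eq,
    setIntegral_univ, setIntegral_univ] at h
  rw [h, ← integral_const_mul]
  simp [ContinuousLinearMap.det, LinearMap.det_toLin']

theorem integral_exp_neg_dotProduct_self_div_two (d : ℕ) :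
    ∫ a : Fin d → ℝ, rexp (-(a ⬝ᵥ a) / 2) = √(2 * π) ^ d := by
  have h : ∀ a : Fin d → ℝ, rexp (-(a ⬝ᵥ a) / 2) = ∏ i, rexp (-(1 / 2) * a i ^ 2) := by
    intro a
    rw [← Real.exp_sum, ← Finset.mul_sum]
    simp only [dotProduct, ← pow_two]
    ring_nf
  simp_rw [h]
  rw [integral_fintype_prod_volume_eq_prod (fun _ t => rexp (-(1 / 2) * t ^ 2))]
  simp only [integral_gaussian, Finset.prod_const, Finset.card_univ, Fintype.card_fin]
  congr 2
  ring

open scoped MatrixOrder in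
theorem integral_exp_neg_dotProduct_mulVec_div_two {d : ℕ} {M : Matrix (Fin d) (Fin d) ℝ}
    (hM : M.PosDef) :
    ∫ a : Fin d → ℝ, rexp (-(a ⬝ᵥ M *ᵥ a) / 2) = √(2 * π) ^ d / √M.det := by
  obtain ⟨R, hR⟩ := CStarAlgebra.nonneg_iff_eq_star_mul_self.mp hM.posSemidef.nonneg
  have hRT : M = Rᵀ * R := by simpa [star_eq_conjTranspose] using hR
  have hdet : M.det = R.det ^ 2 := by rw [hRT, det_mul, det_transpose, sq]
  have hR0 : R.det ≠ 0 := fun h => hM.det_pos.ne' (by simp [hdet, h])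
  have hq : ∀ a, a ⬝ᵥ M *ᵥ a = (R *ᵥ a) ⬝ᵥ (R *ᵥ a) := by
    intro a
    rw [hRT, ← mulVec_mulVec, dotProduct_mulVec, vecMul_transpose]
  have h := abs_det_mul_integral_comp_mulVec R hR0 fun a => rexp (-(a ⬝ᵥ a) / 2)
  rw [integral_exp_neg_dotProduct_self_div_two] at h
  simp_rw [hq]
  rw [hdet, Real.sqrt_sq_eq_abs, eq_div_iff (abs_ne_zero.2 hR0), mul_comm, h]

theorem dotProduct_mulVec_comm_of_isSymm {d : ℕ} {M : Matrix (Fin d) (Fin d) ℝ} (hM : M.IsSymm)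
    (u v : Fin d → ℝ) : u ⬝ᵥ M *ᵥ v = v ⬝ᵥ M *ᵥ u := by
  rw [dotProduct_mulVec, ← mulVec_transpose, hM.eq, dotProduct_comm]

theorem KH_gaussKd_apply {d : ℕ} {A : Matrix (Fin d) (Fin d) ℝ} (hA : A.PosDef) (z : Fin d → ℝ) :
    KH (gaussKd d) A z
      = A.det⁻¹ * ((√(2 * π) ^ d)⁻¹ * rexp (-(z ⬝ᵥ (A⁻¹ * A⁻¹) *ᵥ z) / 2)) := by
  have hsymm : (A⁻¹)ᵀ = A⁻¹ := by simpa using hA.inv.isHermitian.eq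
  have hc : (2 * π) ^ (-(d : ℝ) / 2) = (√(2 * π) ^ d)⁻¹ := by
    rw [Real.sqrt_eq_rpow, ← Real.rpow_natCast, ← Real.rpow_mul (by positivity),
      ← Real.rpow_neg (by positivity)]
    ring_nf
  have hq : z ⬝ᵥ (A⁻¹ * A⁻¹) *ᵥ z = ∑ i, (A⁻¹ *ᵥ z) i ^ 2 := by
    rw [← mulVec_mulVec, dotProduct_mulVec, ← mulVec_transpose, hsymm]
    simp [dotProduct, sq]
  rw [KH, gaussKd, hc, hq]

/-- Completing the square for a sum of two quadratic forms. -/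
theorem quadratic_add_quadratic_eq {d : ℕ} {P Q M T : Matrix (Fin d) (Fin d) ℝ}
    (hQ : Q.IsSymm) (hM : M.IsSymm) (hPQ : P + Q = M)
    (a w m : Fin d → ℝ) (hm : M *ᵥ m = Q *ᵥ w) (hT : Q *ᵥ m + T *ᵥ w = Q *ᵥ w) :
    a ⬝ᵥ P *ᵥ a + (a + w) ⬝ᵥ Q *ᵥ (a + w) = (a + m) ⬝ᵥ M *ᵥ (a + m) + w ⬝ᵥ T *ᵥ w := by
  have h1 : w ⬝ᵥ T *ᵥ w = w ⬝ᵥ Q *ᵥ w - w ⬝ᵥ Q *ᵥ m := by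
    rw [← hT, dotProduct_add]; ring
  have h2 : a ⬝ᵥ P *ᵥ a = a ⬝ᵥ M *ᵥ a - a ⬝ᵥ Q *ᵥ a := by
    rw [← hPQ, add_mulVec, dotProduct_add]; ring
  have h3 := dotProduct_mulVec_comm_of_isSymm hM m a
  have h4 := dotProduct_mulVec_comm_of_isSymm hQ w a
  have h5 := dotProduct_mulVec_comm_of_isSymm hQ m w
  simp only [mulVec_add, dotProduct_add, add_dotProduct, h1, h2, h3, h4, hm, h5]
  ring

theorem KH_gaussKd_pos {d : ℕ} {A : Matrix (Fin d) (Fin d) ℝ} (hA : A.PosDef) (z : Fin d → ℝ) :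
    0 < KH (gaussKd d) A z := by
  have := hA.det_pos
  rw [KH_gaussKd_apply hA]
  positivity

/-- The `L²` inner product of two translated Gaussian kernels. -/
theorem integral_KH_gaussKd_mul {d : ℕ} {A B S : Matrix (Fin d) (Fin d) ℝ}
    (hA : A.PosDef) (hB : B.PosDef) (hS : S.PosDef) (hSS : S * S = A * A + B * B)
    (u v : Fin d → ℝ) :
    ∫ y, KH (gaussKd d) A (y - u) * KH (gaussKd d) B (y - v) = KH (gaussKd d) S (u - v) := by
  have hAd := hA.det_pos
  have hBd := hB.det_pos
  have hSd := hS.det_pos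
  have posDef_mul_self : ∀ {X : Matrix (Fin d) (Fin d) ℝ}, X.PosDef → (X⁻¹ * X⁻¹).PosDef := by
    intro X hX
    have h := PosDef.conjTranspose_mul_self X⁻¹ (mulVec_injective_iff_isUnit.2 hX.inv.isUnit)
    rwa [hX.inv.isHermitian.eq] at h
  have hP := posDef_mul_self hA
  have hQ := posDef_mul_self hB
  set P := A⁻¹ * A⁻¹ with hPdef
  set Q := B⁻¹ * B⁻¹ with hQdef
  set T := S⁻¹ * S⁻¹ with hTdef
  have inv_mul_inv_mul_mul : ∀ {X : Matrix (Fin d) (Fin d) ℝ}, X.PosDef →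
      X⁻¹ * X⁻¹ * (X * X) = 1 := by
    intro X hX
    have uX : IsUnit X.det := hX.det_pos.ne'.isUnit
    rw [Matrix.mul_assoc, ← Matrix.mul_assoc X⁻¹ X X, nonsing_inv_mul X uX, Matrix.one_mul,
      nonsing_inv_mul X uX]
  have hPA : P * (A * A) = 1 := inv_mul_inv_mul_mul hA
  have hAP : (A * A) * P = 1 := mul_eq_one_comm.1 hPA
  have hQB : Q * (B * B) = 1 := inv_mul_inv_mul_mul hB
  have hST : (S * S) * T = 1 := mul_eq_one_comm.1 (inv_mul_inv_mul_mul hS)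
  have hM := hP.add hQ
  have hM_eq : P + Q = Q * (S * S) * P := by
    rw [hSS, Matrix.mul_add, Matrix.add_mul, Matrix.mul_assoc Q (A * A) P, hAP, hQB,
      Matrix.mul_one, Matrix.one_mul, add_comm]
  have hMm : (P + Q) * (A * A * T) = Q := by
    rw [hM_eq, Matrix.mul_assoc, ← Matrix.mul_assoc P, hPA, Matrix.one_mul, Matrix.mul_assoc, hST,
      Matrix.mul_one]
  have hQT : Q * (A * A * T) + T = Q := by
    have : Q * ((A * A + B * B) * T) = Q := by rw [← hSS, hST, Matrix.mul_one]
    rw [Matrix.add_mul, Matrix.mul_add, ← Matrix.mul_assoc Q (B * B) T, hQB, Matrix.one_mul] at this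
    exact this
  have hdet : (P + Q).det = (S.det / (A.det * B.det)) ^ 2 := by
    rw [hM_eq, hPdef, hQdef]
    simp only [det_mul, det_nonsing_inv, Ring.inverse_eq_inv']
    field_simp
  have isSymm_of_posDef : ∀ {X : Matrix (Fin d) (Fin d) ℝ}, X.PosDef → X.IsSymm :=
    fun hX => by simpa [IsSymm] using hX.isHermitian.eq
  set w := u - v with hw
  set m := (A * A * T) *ᵥ w with hm
  have hsq : ∀ y, KH (gaussKd d) A (y - u) * KH (gaussKd d) B (y - v)
      = A.det⁻¹ * B.det⁻¹ * ((√(2 * π) ^ d)⁻¹) ^ 2 * rexp (-(w ⬝ᵥ T *ᵥ w) / 2)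
        * rexp (-((y - (u - m)) ⬝ᵥ (P + Q) *ᵥ (y - (u - m))) / 2) := by
    intro y
    have h := quadratic_add_quadratic_eq (isSymm_of_posDef hQ) (isSymm_of_posDef hM) rfl (y - u) w m
      (by rw [hm, mulVec_mulVec, hMm]) (T := T) (by rw [hm, mulVec_mulVec, ← add_mulVec, hQT])
    have e1 : y - u + w = y - v := by rw [hw]; abel
    have e2 : y - u + m = y - (u - m) := by abel
    rw [e1, e2] at h
    rw [KH_gaussKd_apply hA, KH_gaussKd_apply hB]
    have hexp : rexp (-((y - u) ⬝ᵥ P *ᵥ (y - u)) / 2) * rexp (-((y - v) ⬝ᵥ Q *ᵥ (y - v)) / 2)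
        = rexp (-(w ⬝ᵥ T *ᵥ w) / 2)
          * rexp (-((y - (u - m)) ⬝ᵥ (P + Q) *ᵥ (y - (u - m))) / 2) := by
      rw [← Real.exp_add, ← Real.exp_add]
      congr 1
      linarith
    linear_combination (A.det⁻¹ * B.det⁻¹ * ((√(2 * π) ^ d)⁻¹) ^ 2) * hexp
  simp_rw [hsq]
  rw [integral_const_mul,
    integral_sub_right_eq_self (fun y => rexp (-(y ⬝ᵥ (P + Q) *ᵥ y) / 2)) (u - m),
    integral_exp_neg_dotProduct_mulVec_div_two hM, hdet, Real.sqrt_sq (by positivity),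
    KH_gaussKd_apply hS, ← hTdef]
  have hc : √(2 * π) ^ d ≠ 0 := by positivity
  field_simp

theorem integrable_KH_gaussKd_mul_s19 {d : ℕ} {A B S : Matrix (Fin d) (Fin d) ℝ}
    (hA : A.PosDef) (hB : B.PosDef) (hS : S.PosDef) (hSS : S * S = A * A + B * B)
    (u v : Fin d → ℝ) :
    Integrable fun y => KH (gaussKd d) A (y - u) * KH (gaussKd d) B (y - v) :=
  .of_integral_ne_zero <| by
    rw [integral_KH_gaussKd_mul hA hB hS hSS]
    exact (KH_gaussKd_pos hS _).ne'

/-- Multivariate Gaussian comparison term identity. -/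
theorem gaussian_comparison_term {d : ℕ} (hd : 0 < d) (n : ℕ) (hn : 1 ≤ n)
    (x : Fin n → Fin d → ℝ)
    (H Hmin S : Matrix (Fin d) (Fin d) ℝ)
    (hH : H.PosDef) (hHmin : Hmin.PosDef)
    (hS : S.PosDef) (hSsq : S * S = H ^ 2 + Hmin ^ 2) :
    sqL2 (fun y => kde n (gaussKd d) Hmin x y - kde n (gaussKd d) H x y)
      = (1 / (n : ℝ) ^ 2) * ∑ i : Fin n, ∑ j : Fin n,
          (KH (gaussKd d) (Real.sqrt 2 • H) (x i - x j)
            - 2 * KH (gaussKd d) S (x i - x j)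
            + KH (gaussKd d) (Real.sqrt 2 • Hmin) (x i - x j)) := by
  have sqrt_two_smul_mul_self : ∀ A : Matrix (Fin d) (Fin d) ℝ,
      (√2 • A) * (√2 • A) = A * A + A * A := by
    intro A
    rw [smul_mul_smul_comm, Real.mul_self_sqrt (by norm_num), two_smul]
  have h2 : (0 : ℝ) < √2 := by positivity
  have hH' := hH.smul h2
  have hHmin' := hHmin.smul h2
  have hS1 : S * S = H * H + Hmin * Hmin := by rw [hSsq, sq, sq]
  have hS2 : S * S = Hmin * Hmin + H * H := by rw [hS1, add_comm]
  have hsq : ∀ y, (kde n (gaussKd d) Hmin x y - kde n (gaussKd d) H x y) ^ 2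
      = (1 / (n : ℝ) ^ 2) * ∑ i : Fin n, ∑ j : Fin n,
        (KH (gaussKd d) H (y - x i) * KH (gaussKd d) H (y - x j)
          - KH (gaussKd d) H (y - x i) * KH (gaussKd d) Hmin (y - x j)
          - KH (gaussKd d) Hmin (y - x i) * KH (gaussKd d) H (y - x j)
          + KH (gaussKd d) Hmin (y - x i) * KH (gaussKd d) Hmin (y - x j)) := by
    intro y
    simp only [kde, Finset.sum_add_distrib, Finset.sum_sub_distrib, ← Finset.sum_mul_sum]
    ring
  have iHH i j := integrable_KH_gaussKd_mul_s19 hH hH hH' (sqrt_two_smul_mul_self H) (x i) (x j)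
  have iHm i j := integrable_KH_gaussKd_mul_s19 hH hHmin hS hS1 (x i) (x j)
  have imH i j := integrable_KH_gaussKd_mul_s19 hHmin hH hS hS2 (x i) (x j)
  have imm i j :=
    integrable_KH_gaussKd_mul_s19 hHmin hHmin hHmin' (sqrt_two_smul_mul_self Hmin) (x i) (x j)
  have hint i j := (((iHH i j).sub' (iHm i j)).sub' (imH i j)).fun_add (imm i j)
  rw [sqL2]
  simp_rw [hsq]
  rw [integral_const_mul,
    integral_finsetSum _ fun i _ => integrable_finsetSum _ fun j _ => hint i j]
  congr 1
  refine Finset.sum_congr rfl fun i _ => ?_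
  rw [integral_finsetSum _ fun j _ => hint i j]
  refine Finset.sum_congr rfl fun j _ => ?_
  rw [integral_add (((iHH i j).sub' (iHm i j)).sub' (imH i j)) (imm i j),
    integral_sub ((iHH i j).sub' (iHm i j)) (imH i j), integral_sub (iHH i j) (iHm i j),
    integral_KH_gaussKd_mul hH hH hH' (sqrt_two_smul_mul_self H),
    integral_KH_gaussKd_mul hH hHmin hS hS1, integral_KH_gaussKd_mul hHmin hH hS hS2,
    integral_KH_gaussKd_mul hHmin hHmin hHmin' (sqrt_two_smul_mul_self Hmin)]
  ring
end
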